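/- For every set Δ of formulas of PRED2₀ and every formula φ of PRED2₀, the semantic consequence Δ ⊩ φ holds if and only if the derivability Δ ⊢ φ holds in PRED2₀. -/

import Mathlib

/-! Infrastructure: the system PRED2₀ of first-order many-sorted intuitionistic
predicate logic with second-order propositional quantifiers, and its (simplified)
Kripke semantics, following Czajka, "A semantic approach to illative combinatory
logic", Section 2. -/

namespace PRED2

/-- Types of PRED2₀ : `τ ::= o | B | B → τ`, for a set `B` of base types. -/
inductive Ty (B : Type) : Type
  | o : Ty B
  | base : B → Ty B
  | arr : B → Ty B → Ty B
deriving DecidableEq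

/-- The types over which quantification is allowed: `B ∪ {o}`. -/
def QTy {B : Type} (τ : Ty B) : Prop := τ = .o ∨ ∃ b, τ = .base b

/-- Terms of PRED2₀ over a signature `Con` (with `Con τ` the constants of type `τ`).
Variables of type `τ` are indexed by natural numbers.  Terms of type `.o` are the
formulas. -/
inductive Trm (B : Type) (Con : Ty B → Type) : Ty B → Type
  | var (τ : Ty B) (n : Nat) : Trm B Con τ
  | con {τ : Ty B} (c : Con τ) : Trm B Con τ
  | app {b : B} {τ : Ty B} (f : Trm B Con (.arr b τ)) (a : Trm B Con (.base b)) : Trm B Con τ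
  | imp (φ ψ : Trm B Con .o) : Trm B Con .o
  | all (τ : Ty B) (hτ : QTy τ) (m : Nat) (φ : Trm B Con .o) : Trm B Con .o

variable {B : Type} [DecidableEq B] {Con : Ty B → Type}

/-- Free variables of a term (a variable is a pair of its type and its index). -/
def FV : {τ : Ty B} → Trm B Con τ → Finset (Ty B × Nat)
  | _, .var τ n => {(τ, n)}
  | _, .con _ => ∅
  | _, .app f a => FV f ∪ FV a
  | _, .imp φ ψ => FV φ ∪ FV ψ
  | _, .all τ _ m φ => (FV φ).erase (τ, m)

/-- Update a (term-valued) valuation at the variable `(τ0, m)`. -/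
def vupd (v : ∀ τ : Ty B, Nat → Trm B Con τ) (τ0 : Ty B) (m : Nat) (t : Trm B Con τ0) :
    ∀ τ : Ty B, Nat → Trm B Con τ :=
  fun τ n => if h : τ = τ0 then (if n = m then h.symm ▸ t else v τ n) else v τ n

/-- The identity substitution. -/
def vid : ∀ τ : Ty B, Nat → Trm B Con τ := fun τ n => .var τ n

/-- A number strictly larger than the index of any variable free in any `v y`
for `y ∈ s`; used to choose fresh names for bound variables. -/
def fresh (v : ∀ τ : Ty B, Nat → Trm B Con τ) (s : Finset (Ty B × Nat)) : Nat :=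
  (s.sup fun y => (FV (v y.1 y.2)).sup fun z => z.2) + 1

/-- Simultaneous capture-avoiding substitution: bound variables are renamed to
fresh ones so that no free variable of the substituted terms is captured. -/
def substV (v : ∀ τ : Ty B, Nat → Trm B Con τ) : {τ : Ty B} → Trm B Con τ → Trm B Con τ
  | _, .var τ n => v τ n
  | _, .con c => .con c
  | _, .app f a => .app (substV v f) (substV v a)
  | _, .imp φ ψ => .imp (substV v φ) (substV v ψ)
  | _, .all τ h m φ =>
      let m' := fresh v ((FV φ).erase (τ, m))
      .all τ h m' (substV (vupd v τ m (.var τ m')) φ)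

/-- `φ[x/t]` : capture-avoiding substitution of the term `t` for all free
occurrences of the variable `x = (τ, m)`. -/
def subst1 (τ : Ty B) (m : Nat) (t : Trm B Con τ) {τ' : Ty B} (φ : Trm B Con τ') :
    Trm B Con τ' :=
  substV (vupd vid τ m t) φ

/-- Derivability in PRED2₀ (for a set `Δ` of hypotheses; the rules are the axiom,
`⊃`-introduction and elimination, and `∀`-introduction and elimination). -/
inductive Deriv : Set (Trm B Con .o) → Trm B Con .o → Prop
  | ax {Δ : Set (Trm B Con .o)} {φ} : φ ∈ Δ → Deriv Δ φ
  | impI {Δ : Set (Trm B Con .o)} {φ ψ} : Deriv (insert φ Δ) ψ → Deriv Δ (.imp φ ψ)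
  | impE {Δ : Set (Trm B Con .o)} {φ ψ} : Deriv Δ (.imp φ ψ) → Deriv Δ φ → Deriv Δ ψ
  | allI {Δ : Set (Trm B Con .o)} (τ : Ty B) (hτ : QTy τ) (m : Nat) {φ} :
      Deriv Δ φ → (∀ ψ ∈ Δ, (τ, m) ∉ FV ψ) → Deriv Δ (.all τ hτ m φ)
  | allE {Δ : Set (Trm B Con .o)} {τ : Ty B} {hτ : QTy τ} {m : Nat} {φ} (t : Trm B Con τ) :
      Deriv Δ (.all τ hτ m φ) → Deriv Δ (subst1 τ m t φ)

/-- `Δ ⊢ φ` for an arbitrary set `Δ`: some finite subset of `Δ` derives `φ`. -/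
def DerivFrom (Δ : Set (Trm B Con .o)) (φ : Trm B Con .o) : Prop :=
  ∃ Δ' ⊆ Δ, Δ'.Finite ∧ Deriv Δ' φ

/-- Update a (domain-valued) valuation at the variable `(τ0, m)`. -/
def uupd {D : Ty B → Type} (u : ∀ τ, Nat → D τ) (τ0 : Ty B) (m : Nat) (d : D τ0) :
    ∀ τ, Nat → D τ :=
  fun τ n => if h : τ = τ0 then (if n = m then h.symm ▸ d else u τ n) else u τ n

/-- A Kripke model for PRED2₀: a partially ordered set of states, nonempty domains,
an application operation, an interpretation of constants, an interpretation
function `val` for terms (homomorphic on variables, constants and applications),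
and a function `sigma` assigning upward-closed sets of states to elements of `D .o`,
such that the forcing conditions for `⊃` and `∀` hold and `∀p.p` is never forced. -/
structure KModel (B : Type) [DecidableEq B] (Con : Ty B → Type) where
  /-- states -/
  St : Type
  le : St → St → Prop
  le_refl : ∀ s, le s s
  le_trans : ∀ {a b c}, le a b → le b c → le a c
  le_antisymm : ∀ {a b}, le a b → le b a → a = b
  /-- domains -/
  D : Ty B → Type
  Dne : ∀ τ, Nonempty (D τ)
  /-- application -/
  ap : ∀ {b : B} {τ : Ty B}, D (.arr b τ) → D (.base b) → D τ
  /-- interpretation of constants -/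
  I : ∀ {τ : Ty B}, Con τ → D τ
  sigma : D .o → Set St
  upclosed : ∀ (d : D .o) {s s'}, le s s' → s ∈ sigma d → s' ∈ sigma d
  /-- interpretation of terms under a valuation -/
  val : (∀ τ, Nat → D τ) → ∀ {τ : Ty B}, Trm B Con τ → D τ
  val_var : ∀ u (τ : Ty B) (n : Nat), val u (.var τ n) = u τ n
  val_con : ∀ u {τ : Ty B} (c : Con τ), val u (.con c) = I c
  val_app : ∀ u {b : B} {τ : Ty B} (f : Trm B Con (.arr b τ)) (a : Trm B Con (.base b)),
    val u (.app f a) = ap (val u f) (val u a)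
  forces_imp : ∀ s u (φ ψ : Trm B Con .o),
    s ∈ sigma (val u (.imp φ ψ)) ↔
      ∀ s', le s s' → s' ∈ sigma (val u φ) → s' ∈ sigma (val u ψ)
  forces_all : ∀ s u (τ : Ty B) (hτ : QTy τ) (m : Nat) (φ : Trm B Con .o),
    s ∈ sigma (val u (.all τ hτ m φ)) ↔
      ∀ s', le s s' → ∀ d : D τ, s' ∈ sigma (val (uupd u τ m d) φ)
  forces_allpp : ∀ s u (n : Nat),
    s ∉ sigma (val u (.all .o (Or.inl rfl) n (.var .o n)))

/-- `s, u ⊩ φ` : the formula `φ` is forced at state `s` under valuation `u`. -/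
def Forces (M : KModel B Con) (s : M.St) (u : ∀ τ, Nat → M.D τ) (φ : Trm B Con .o) : Prop :=
  s ∈ M.sigma (M.val u φ)

section Substitution

lemma vupd_same (v : ∀ τ : Ty B, Nat → Trm B Con τ) (τ : Ty B) (m : Nat) (t : Trm B Con τ) :
    vupd v τ m t τ m = t := by
  simp [vupd]

lemma vupd_ne (v : ∀ τ : Ty B, Nat → Trm B Con τ) {τ : Ty B} {m : Nat} (t : Trm B Con τ)
    {y : Ty B × Nat} (hy : y ≠ (τ, m)) : vupd v τ m t y.1 y.2 = v y.1 y.2 := by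
  obtain ⟨σ, n⟩ := y
  by_cases h : σ = τ
  · subst h
    have hn : n ≠ m := fun hn => hy (by rw [hn])
    simp [vupd, hn]
  · simp [vupd, h]

lemma lt_fresh (v : ∀ τ : Ty B, Nat → Trm B Con τ) {s : Finset (Ty B × Nat)} {y : Ty B × Nat}
    (hy : y ∈ s) {z : Ty B × Nat} (hz : z ∈ FV (v y.1 y.2)) : z.2 < fresh v s := by
  have h1 : z.2 ≤ (FV (v y.1 y.2)).sup fun z => z.2 := Finset.le_sup (f := fun z => z.2) hz
  have h2 : ((FV (v y.1 y.2)).sup fun z => z.2) ≤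
      s.sup fun y => (FV (v y.1 y.2)).sup fun z => z.2 :=
    Finset.le_sup (f := fun y : Ty B × Nat => (FV (v y.1 y.2)).sup fun z => z.2) hy
  unfold fresh
  omega

lemma fresh_notMem (v : ∀ τ : Ty B, Nat → Trm B Con τ) {s : Finset (Ty B × Nat)}
    {y : Ty B × Nat} (hy : y ∈ s) (τ : Ty B) : (τ, fresh v s) ∉ FV (v y.1 y.2) :=
  fun h => lt_irrefl _ (lt_fresh v hy h)

lemma fresh_congr {v w : ∀ τ : Ty B, Nat → Trm B Con τ} {s : Finset (Ty B × Nat)}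
    (h : ∀ y ∈ s, v y.1 y.2 = w y.1 y.2) : fresh v s = fresh w s := by
  unfold fresh
  rw [Finset.sup_congr rfl fun y hy => by rw [h y hy]]

/-- Substitution only depends on the values at the free variables. -/
lemma substV_congr {τ : Ty B} (t : Trm B Con τ) {v w : ∀ τ : Ty B, Nat → Trm B Con τ}
    (h : ∀ y ∈ FV t, v y.1 y.2 = w y.1 y.2) : substV v t = substV w t := by
  induction t generalizing v w with
  | var τ n => exact h (τ, n) (by simp [FV])
  | con c => rfl
  | app f a ihf iha =>
    simp only [substV]
    rw [ihf fun y hy => h y (by simp [FV, hy]), iha fun y hy => h y (by simp [FV, hy])]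
  | imp φ ψ ihφ ihψ =>
    simp only [substV]
    rw [ihφ fun y hy => h y (by simp [FV, hy]), ihψ fun y hy => h y (by simp [FV, hy])]
  | all τ hτ m φ ih =>
    simp only [substV]
    have hf : fresh v ((FV φ).erase (τ, m)) = fresh w ((FV φ).erase (τ, m)) := fresh_congr h
    rw [hf]
    congr 1
    refine ih fun y hy => ?_
    by_cases hym : y = (τ, m)
    · subst hym; simp [vupd_same]
    · rw [vupd_ne _ _ hym, vupd_ne _ _ hym]
      exact h y (by simp [FV, hy, hym])

lemma mem_FV_substV {τ : Ty B} (t : Trm B Con τ) (v : ∀ τ : Ty B, Nat → Trm B Con τ)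
    (z : Ty B × Nat) : z ∈ FV (substV v t) ↔ ∃ y ∈ FV t, z ∈ FV (v y.1 y.2) := by
  induction t generalizing v with
  | var τ n => simp [FV, substV]
  | con c => simp [FV, substV]
  | app f a ihf iha =>
    simp only [FV, substV, Finset.mem_union, ihf, iha, or_and_right, exists_or]
  | imp φ ψ ihφ ihψ =>
    simp only [FV, substV, Finset.mem_union, ihφ, ihψ, or_and_right, exists_or]
  | all τ hτ m φ ih =>
    simp only [FV, substV, Finset.mem_erase, ih]
    constructor
    · rintro ⟨hz, y, hy, hzy⟩
      by_cases hym : y = (τ, m)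
      · subst hym
        simp only [vupd_same, FV, Finset.mem_singleton] at hzy
        exact absurd hzy hz
      · rw [vupd_ne _ _ hym] at hzy
        exact ⟨y, ⟨hym, hy⟩, hzy⟩
    · rintro ⟨y, ⟨hym, hy⟩, hzy⟩
      refine ⟨?_, y, hy, by rwa [vupd_ne _ _ hym]⟩
      rintro rfl
      exact fresh_notMem v (Finset.mem_erase.2 ⟨hym, hy⟩) τ hzy

/-- Binding a renamed variable and then substituting is the same as substituting under the
original binder. -/
lemma substV_all_rename {τ : Ty B} {hτ : QTy τ} {m k : Nat} {φ : Trm B Con .o}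
    (hφ : ∀ v w : ∀ τ : Ty B, Nat → Trm B Con τ,
      substV v (substV w φ) = substV (fun σ n => substV v (w σ n)) φ)
    (v w : ∀ τ : Ty B, Nat → Trm B Con τ)
    (hk : ∀ y ∈ (FV φ).erase (τ, m), (τ, k) ∉ FV (w y.1 y.2)) :
    substV v (.all τ hτ k (substV (vupd w τ m (.var τ k)) φ)) =
      substV (fun σ n => substV v (w σ n)) (.all τ hτ m φ) := by
  have hmem : ∀ z : Ty B × Nat, z ∈ (FV (substV (vupd w τ m (.var τ k)) φ)).erase (τ, k) ↔
      ∃ y ∈ (FV φ).erase (τ, m), z ∈ FV (w y.1 y.2) := by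
    intro z
    rw [Finset.mem_erase, mem_FV_substV]
    constructor
    · rintro ⟨hz, y, hy, hzy⟩
      by_cases hym : y = (τ, m)
      · subst hym
        simp only [vupd_same, FV, Finset.mem_singleton] at hzy
        exact absurd hzy hz
      · rw [vupd_ne _ _ hym] at hzy
        exact ⟨y, Finset.mem_erase.2 ⟨hym, hy⟩, hzy⟩
    · rintro ⟨y, hy, hzy⟩
      refine ⟨?_, y, Finset.mem_of_mem_erase hy, by rwa [vupd_ne _ _ (Finset.ne_of_mem_erase hy)]⟩
      rintro rfl
      exact hk y hy hzy
  have hfresh : fresh v ((FV (substV (vupd w τ m (.var τ k)) φ)).erase (τ, k)) =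
      fresh (fun σ n => substV v (w σ n)) ((FV φ).erase (τ, m)) := by
    unfold fresh
    congr 1
    apply le_antisymm
    · refine Finset.sup_le fun z hz => Finset.sup_le fun x hx => ?_
      obtain ⟨y, hy, hzy⟩ := (hmem z).1 hz
      refine le_trans ?_ (Finset.le_sup (f := fun y : Ty B × Nat =>
        (FV (substV v (w y.1 y.2))).sup fun z => z.2) hy)
      exact Finset.le_sup (f := fun z : Ty B × Nat => z.2)
        ((mem_FV_substV _ _ _).2 ⟨z, hzy, hx⟩)
    · refine Finset.sup_le fun y hy => Finset.sup_le fun x hx => ?_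
      obtain ⟨z, hzy, hx⟩ := (mem_FV_substV _ _ _).1 hx
      refine le_trans ?_ (Finset.le_sup (f := fun y : Ty B × Nat =>
        (FV (v y.1 y.2)).sup fun z => z.2) ((hmem z).2 ⟨y, hy, hzy⟩))
      exact Finset.le_sup (f := fun z : Ty B × Nat => z.2) hx
  simp only [substV]
  rw [hfresh, hφ]
  congr 1
  refine substV_congr φ fun y hy => ?_
  by_cases hym : y = (τ, m)
  · subst hym; simp [vupd_same, substV]
  · rw [vupd_ne _ _ hym, vupd_ne _ _ hym]
    refine substV_congr _ fun z hz => vupd_ne _ _ ?_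
    rintro rfl
    exact hk y (Finset.mem_erase.2 ⟨hym, hy⟩) hz

/-- Composition of substitutions; no renaming of bound variables is involved. -/
lemma substV_comp {τ : Ty B} (t : Trm B Con τ) (v w : ∀ τ : Ty B, Nat → Trm B Con τ) :
    substV v (substV w t) = substV (fun σ n => substV v (w σ n)) t := by
  induction t generalizing v w with
  | var τ n => rfl
  | con c => rfl
  | app f a ihf iha => simp only [substV, ihf, iha]
  | imp φ ψ ihφ ihψ => simp only [substV, ihφ, ihψ]
  | all τ hτ m φ ih =>
    exact substV_all_rename ih v w fun y hy => fresh_notMem w hy τ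

lemma vid_all_rename {τ : Ty B} (hτ : QTy τ) {m k : Nat} (φ : Trm B Con .o)
    (w : ∀ τ : Ty B, Nat → Trm B Con τ)
    (hk : ∀ y ∈ (FV φ).erase (τ, m), (τ, k) ∉ FV (w y.1 y.2)) :
    substV vid (.all τ hτ k (substV (vupd w τ m (.var τ k)) φ)) =
      substV vid (substV w (.all τ hτ m φ)) := by
  rw [substV_all_rename (substV_comp φ) vid w hk, substV_comp]

end Substitution

section Derivability

lemma mem_FV_vid {τ : Ty B} (t : Trm B Con τ) (z : Ty B × Nat) :
    z ∈ FV (substV vid t) ↔ z ∈ FV t := by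
  rw [mem_FV_substV]
  simp [vid, FV]

lemma vupd_vid_self (τ : Ty B) (m : Nat) :
    vupd (vid : ∀ τ : Ty B, Nat → Trm B Con τ) τ m (.var τ m) = vid := by
  funext σ n
  by_cases h : ((σ, n) : Ty B × Nat) = (τ, m)
  · obtain ⟨rfl, rfl⟩ := Prod.mk.inj h
    rw [vupd_same]; rfl
  · exact vupd_ne vid _ h

lemma exists_index_bound {Γ : Set (Trm B Con .o)} (hΓ : Γ.Finite) :
    ∃ n : Nat, ∀ ψ ∈ Γ, ∀ z ∈ FV ψ, z.2 < n := by
  induction Γ, hΓ using Set.Finite.induction_on with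
  | empty => exact ⟨0, by simp⟩
  | @insert ψ Γ _ _ ih =>
    obtain ⟨n, hn⟩ := ih
    refine ⟨max n ((FV ψ).sup (fun z => z.2) + 1), ?_⟩
    rintro χ (rfl | hχ) z hz
    · have : z.2 ≤ (FV χ).sup fun z => z.2 := Finset.le_sup (f := fun z => z.2) hz
      exact lt_max_of_lt_right (Nat.lt_succ_of_le this)
    · exact lt_max_of_lt_left (hn χ hχ z hz)

lemma Deriv.to_vid {Γ : Set (Trm B Con .o)} (hΓ : Γ.Finite) {ψ : Trm B Con .o}
    (h : Deriv Γ ψ) : Deriv Γ (substV vid ψ) := by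
  obtain ⟨n, hn⟩ := exists_index_bound hΓ
  have h1 : Deriv Γ (.all .o (Or.inl rfl) n ψ) :=
    .allI _ _ n h fun χ hχ hz => lt_irrefl _ (hn χ hχ _ hz)
  have h2 := Deriv.allE (.var .o n) h1
  rwa [subst1, vupd_vid_self] at h2

/-- The derivation instantiates a propositional variable `p` with `N` itself in
`(∀ r, (p ⊃ r) ⊃ (C ⊃ r)) ⊃ (C ⊃ p)`, where `C` is `N` with its bound variables renamed.  The
vacuous premise `d ⊃ d` pushes the name chosen for `r` above the free variables of `Γ`. -/
lemma Deriv.vid_imp {Γ : Set (Trm B Con .o)} (hΓ : Γ.Finite) (N : Trm B Con .o) :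
    Deriv Γ (.imp (substV vid N) N) := by
  obtain ⟨M, hM⟩ := exists_index_bound (hΓ.insert N)
  have hN : ∀ z ∈ FV N, z.2 < M := hM N (Set.mem_insert _ _)
  have hΓM : ∀ ψ ∈ Γ, ∀ z ∈ FV ψ, z.2 < M := fun ψ hψ => hM ψ (Set.mem_insert_of_mem _ hψ)
  have ho : QTy (Ty.o : Ty B) := Or.inl rfl
  set C := substV vid N with hC
  have subst_C : ∀ (k : Nat) (t : Trm B Con .o), M ≤ k → substV (vupd vid .o k t) C = C := by
    intro k t hk
    rw [hC, substV_comp]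
    refine substV_congr N fun y hy => ?_
    refine vupd_ne vid t ?_
    rintro rfl
    exact absurd (hN _ hy) (not_lt.2 hk)
  let p : Trm B Con .o := .var .o M
  let D : Trm B Con .o := .imp (.var .o (M + 1)) (.var .o (M + 1))
  let r : Trm B Con .o := .var .o (M + 2)
  let body : Trm B Con .o := .imp (.imp p r) (.imp D (.imp C r))
  let A : Trm B Con .o := .all .o ho (M + 2) body
  have main : Deriv Γ (.all .o ho M (.imp A (.imp D (.imp C p)))) := by
    refine .allI _ _ _ ?_ fun ψ hψ hz => lt_irrefl _ (hΓM ψ hψ _ hz)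
    refine .impI (.impI (.impI ?_))
    have hA : Deriv (insert C (insert D (insert A Γ))) (subst1 .o (M + 2) p body) :=
      .allE (hτ := ho) p (.ax (by simp [A]))
    have hsub : subst1 .o (M + 2) p body = .imp (.imp p p) (.imp D (.imp C p)) := by
      simp only [subst1, body, substV, subst_C _ _ (Nat.le_add_right M 2), p, r, D]
      simp [vupd, vid]
    rw [hsub] at hA
    exact .impE (.impE (.impE hA (.impI (.ax (by simp)))) (.ax (by simp))) (.ax (by simp))
  have inst := Deriv.allE N main
  let v := vupd vid .o M N
  let s := (FV body).erase (.o, M + 2)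
  let k := fresh v s
  let v' := vupd v .o (M + 2) (.var .o k)
  have hk : M + 1 < k := by
    refine lt_fresh v (s := s) (y := (.o, M + 1)) (z := (.o, M + 1)) ?_ ?_
    · simp [s, body, FV, D]
    · simp [v, vupd, vid, FV]
  have hsub : subst1 .o M N (.imp A (.imp D (.imp C p))) =
      .imp (.all .o ho k (.imp (.imp N (.var .o k)) (.imp D (.imp C (.var .o k)))))
        (.imp D (.imp C N)) := by
    have hv : ∀ n, v .o n = if n = M then N else .var .o n := fun n => by simp [v, vupd, vid]
    have hv' : ∀ n, v' .o n = if n = M + 2 then .var .o k else v .o n :=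
      fun n => by simp [v', vupd]
    have hCv : substV v C = C := subst_C M N le_rfl
    have hCv' : substV v' C = C := by
      refine Eq.trans (substV_congr C fun y hy => vupd_ne v _ ?_) hCv
      rintro rfl
      have := hN _ ((mem_FV_vid N _).1 hy)
      simp at this
    have hAv : substV v A = .all .o ho k (substV v' body) := rfl
    have hbody : substV v' body =
        .imp (.imp N (.var .o k)) (.imp D (.imp C (.var .o k))) := by
      simp only [body, substV, hCv', p, r, D, hv', hv]
      simp
    have hrest : substV v (.imp D (.imp C p)) = .imp D (.imp C N) := by
      simp only [substV, hCv, p, D, hv]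
      simp
    change Trm.imp (substV v A) (substV v (.imp D (.imp C p))) = _
    rw [hAv, hbody, hrest]
  rw [hsub] at inst
  refine .impE (.impE inst (.allI _ _ _ (.impI (.impI (.impI ?_))) ?_)) (.impI (.ax (by simp)))
  · have hfin : (insert C (insert D (insert (Trm.imp N (.var .o k)) Γ))).Finite :=
      ((hΓ.insert _).insert _).insert _
    have h1 : Deriv (insert C (insert D (insert (Trm.imp N (.var .o k)) Γ)))
        (.imp N (.var .o k)) := .ax (by simp)
    exact .impE (h1.to_vid hfin) (.ax (Or.inl rfl))
  · intro ψ hψ hz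
    have := hΓM ψ hψ _ hz
    simp only at this
    omega

lemma Deriv.of_vid {Γ : Set (Trm B Con .o)} (hΓ : Γ.Finite) {ψ : Trm B Con .o}
    (h : Deriv Γ (substV vid ψ)) : Deriv Γ ψ :=
  .impE (.vid_imp hΓ ψ) h

lemma Deriv.of_vid_eq {Γ : Set (Trm B Con .o)} (hΓ : Γ.Finite) {ψ χ : Trm B Con .o}
    (h : Deriv Γ ψ) (e : substV vid ψ = substV vid χ) : Deriv Γ χ :=
  .of_vid hΓ (e ▸ h.to_vid hΓ)

/-- Instantiating a renamed bound variable agrees, up to the names of bound variables, with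
substituting for the original one. -/
lemma vid_subst1_substV {τ : Ty B} {m k : Nat} (t : Trm B Con τ) {σ : Ty B} (φ : Trm B Con σ)
    (v : ∀ τ : Ty B, Nat → Trm B Con τ)
    (hk : ∀ y ∈ (FV φ).erase (τ, m), (τ, k) ∉ FV (v y.1 y.2)) :
    substV vid (subst1 τ k t (substV (vupd v τ m (.var τ k)) φ)) =
      substV vid (substV (vupd v τ m t) φ) := by
  rw [subst1, substV_comp φ, substV_comp, substV_comp]
  refine substV_congr φ fun y hy => ?_
  by_cases hym : y = (τ, m)
  · subst hym; simp [vupd_same, substV]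
  · rw [vupd_ne _ _ hym, vupd_ne _ _ hym, substV_comp]
    refine substV_congr _ fun z hz => ?_
    rw [vupd_ne]
    · rfl
    · rintro rfl
      exact hk y (Finset.mem_erase.2 ⟨hym, hy⟩) hz

/-- Derivability is closed under substitution and under enlarging finite sets of hypotheses. -/
lemma Deriv.substV_weaken {Δ : Set (Trm B Con .o)} {φ : Trm B Con .o} (h : Deriv Δ φ)
    (hΔ : Δ.Finite) (v : ∀ τ : Ty B, Nat → Trm B Con τ) {Γ : Set (Trm B Con .o)}
    (hΓ : Γ.Finite)
    (hyp : ∀ ψ ∈ Δ, ∀ Γ' : Set (Trm B Con .o), Γ'.Finite → Γ ⊆ Γ' → Deriv Γ' (substV v ψ)) :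
    Deriv Γ (substV v φ) := by
  induction h generalizing v Γ with
  | ax h => exact hyp _ h Γ hΓ subset_rfl
  | @impI Δ φ ψ _ ih =>
    refine .impI (ih (hΔ.insert _) v (hΓ.insert _) ?_)
    rintro χ (rfl | hχ) Γ' hΓ' hs
    · exact .ax (hs (Set.mem_insert _ _))
    · exact hyp χ hχ Γ' hΓ' ((Set.subset_insert _ _).trans hs)
  | impE _ _ ih1 ih2 => exact .impE (ih1 hΔ v hΓ hyp) (ih2 hΔ v hΓ hyp)
  | @allI Δ τ hτ m φ _ hm ih =>
    obtain ⟨n, hn⟩ := exists_index_bound hΓ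
    let k := max n (fresh v ((FV φ).erase (τ, m)))
    have hk : ∀ y ∈ (FV φ).erase (τ, m), (τ, k) ∉ FV (v y.1 y.2) := by
      intro y hy hz
      have := lt_fresh v hy hz
      exact absurd this (not_lt.2 (le_max_right _ _))
    refine Deriv.of_vid_eq hΓ (.allI τ hτ k (ih hΔ (vupd v τ m (.var τ k)) hΓ ?_) ?_)
      (vid_all_rename hτ φ v hk)
    · intro ψ hψ Γ' hΓ' hs
      have e : substV (vupd v τ m (.var τ k)) ψ = substV v ψ := by
        refine substV_congr ψ fun y hy => vupd_ne _ _ ?_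
        rintro rfl
        exact hm ψ hψ hy
      rw [e]
      exact hyp ψ hψ Γ' hΓ' hs
    · intro ψ hψ hz
      exact absurd (hn ψ hψ _ hz) (not_lt.2 (le_max_left _ _))
  | @allE Δ τ hτ m φ t _ ih =>
    have h1 := Deriv.allE (substV v t) (ih hΔ v hΓ hyp)
    refine h1.of_vid_eq hΓ ?_
    rw [vid_subst1_substV _ _ _ fun y hy => fresh_notMem v hy τ, subst1, substV_comp φ v]
    congr 1
    refine substV_congr φ fun y hy => ?_
    by_cases hym : y = (τ, m)
    · subst hym; simp [vupd_same]
    · rw [vupd_ne _ _ hym, vupd_ne _ _ hym]; rfl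

lemma Deriv.weaken {Δ Γ : Set (Trm B Con .o)} {φ : Trm B Con .o} (h : Deriv Δ φ)
    (hΓ : Γ.Finite) (hs : Δ ⊆ Γ) : Deriv Γ φ :=
  .of_vid hΓ (h.substV_weaken (hΓ.subset hs) vid hΓ fun _ hψ _ hΓ' hs' =>
    (Deriv.ax (hs' (hs hψ))).to_vid hΓ')

namespace DerivFrom

variable {Γ Γ' : Set (Trm B Con .o)} {φ ψ : Trm B Con .o}

lemma ax (h : φ ∈ Γ) : DerivFrom Γ φ :=
  ⟨{φ}, by simpa using h, Set.finite_singleton _, .ax rfl⟩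

lemma mono (hs : Γ ⊆ Γ') (h : DerivFrom Γ φ) : DerivFrom Γ' φ := by
  obtain ⟨Δ, hΔ, hfin, hd⟩ := h
  exact ⟨Δ, hΔ.trans hs, hfin, hd⟩

lemma impI (h : DerivFrom (insert φ Γ) ψ) : DerivFrom Γ (.imp φ ψ) := by
  obtain ⟨Δ, hΔ, hfin, hd⟩ := h
  refine ⟨Δ \ {φ}, ?_, hfin.subset Set.sdiff_subset, .impI (hd.weaken ?_ ?_)⟩
  · rintro χ ⟨h1, h2⟩
    exact (hΔ h1).resolve_left h2
  · exact (hfin.subset Set.sdiff_subset).insert _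
  · intro χ hχ
    by_cases e : χ = φ
    · exact Or.inl e
    · exact Or.inr ⟨hχ, e⟩

lemma impE (h1 : DerivFrom Γ (.imp φ ψ)) (h2 : DerivFrom Γ φ) : DerivFrom Γ ψ := by
  obtain ⟨Δ1, hΔ1, hfin1, hd1⟩ := h1
  obtain ⟨Δ2, hΔ2, hfin2, hd2⟩ := h2
  have hfin := hfin1.union hfin2
  exact ⟨Δ1 ∪ Δ2, Set.union_subset hΔ1 hΔ2, hfin,
    .impE (hd1.weaken hfin Set.subset_union_left) (hd2.weaken hfin Set.subset_union_right)⟩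

lemma allI (τ : Ty B) (hτ : QTy τ) (m : Nat) (h : DerivFrom Γ φ)
    (hm : ∀ ψ ∈ Γ, (τ, m) ∉ FV ψ) : DerivFrom Γ (.all τ hτ m φ) := by
  obtain ⟨Δ, hΔ, hfin, hd⟩ := h
  exact ⟨Δ, hΔ, hfin, .allI τ hτ m hd fun ψ hψ => hm ψ (hΔ hψ)⟩

lemma allE {τ : Ty B} {hτ : QTy τ} {m : Nat} (t : Trm B Con τ)
    (h : DerivFrom Γ (.all τ hτ m φ)) : DerivFrom Γ (subst1 τ m t φ) := by
  obtain ⟨Δ, hΔ, hfin, hd⟩ := h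
  exact ⟨Δ, hΔ, hfin, .allE t hd⟩

lemma of_vid_eq (h : DerivFrom Γ φ) (e : substV vid φ = substV vid ψ) : DerivFrom Γ ψ := by
  obtain ⟨Δ, hΔ, hfin, hd⟩ := h
  exact ⟨Δ, hΔ, hfin, hd.of_vid_eq hfin e⟩

lemma exfalso {n : Nat} (h : DerivFrom Γ (.all .o (Or.inl rfl) n (.var .o n))) :
    DerivFrom Γ ψ := by
  have := h.allE ψ
  rwa [subst1, substV, vupd_same] at this

end DerivFrom

end Derivability

section Soundness

/-- Two elements of a domain are indistinguishable: they force at the same states when they are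
propositions, and are equal otherwise. -/
def KModel.Indist (M : KModel B Con) : {τ : Ty B} → M.D τ → M.D τ → Prop
  | .o, x, y => M.sigma x = M.sigma y
  | .base _, x, y => x = y
  | .arr _ _, x, y => x = y

lemma KModel.Indist.refl (M : KModel B Con) {τ : Ty B} (x : M.D τ) : M.Indist x x := by
  cases τ <;> rfl

lemma uupd_same {D : Ty B → Type} (u : ∀ τ, Nat → D τ) (τ : Ty B) (m : Nat) (d : D τ) :
    uupd u τ m d τ m = d := by
  simp [uupd]

lemma uupd_ne {D : Ty B → Type} (u : ∀ τ, Nat → D τ) {τ : Ty B} {m : Nat} (d : D τ)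
    {y : Ty B × Nat} (hy : y ≠ (τ, m)) : uupd u τ m d y.1 y.2 = u y.1 y.2 := by
  obtain ⟨σ, n⟩ := y
  by_cases h : σ = τ
  · subst h
    have hn : n ≠ m := fun hn => hy (by rw [hn])
    simp [uupd, hn]
  · simp [uupd, h]

lemma KModel.val_congr (M : KModel B Con) {τ : Ty B} (t : Trm B Con τ)
    {u u' : ∀ τ, Nat → M.D τ} (h : ∀ y ∈ FV t, M.Indist (u y.1 y.2) (u' y.1 y.2)) :
    M.Indist (M.val u t) (M.val u' t) := by
  induction t generalizing u u' with
  | var τ n =>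
    rw [M.val_var, M.val_var]
    exact h (τ, n) (by simp [FV])
  | con c =>
    rw [M.val_con, M.val_con]
    exact .refl M _
  | app f a ihf iha =>
    have hf : M.val u f = M.val u' f := ihf fun y hy => h y (by simp [FV, hy])
    have ha : M.val u a = M.val u' a := iha fun y hy => h y (by simp [FV, hy])
    rw [M.val_app, M.val_app, hf, ha]
    exact .refl M _
  | imp φ ψ ihφ ihψ =>
    have hφ : M.sigma (M.val u φ) = M.sigma (M.val u' φ) :=
      ihφ fun y hy => h y (by simp [FV, hy])
    have hψ : M.sigma (M.val u ψ) = M.sigma (M.val u' ψ) :=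
      ihψ fun y hy => h y (by simp [FV, hy])
    ext s
    rw [M.forces_imp, M.forces_imp, hφ, hψ]
  | all τ hτ m φ ih =>
    ext s
    rw [M.forces_all, M.forces_all]
    have hφ : ∀ d, M.sigma (M.val (uupd u τ m d) φ) = M.sigma (M.val (uupd u' τ m d) φ) := by
      refine fun d => ih fun y hy => ?_
      by_cases hym : y = (τ, m)
      · subst hym
        rw [uupd_same, uupd_same]
        exact .refl M _
      · rw [uupd_ne _ _ hym, uupd_ne _ _ hym]
        exact h y (by simp [FV, hy, hym])
    simp only [hφ]

lemma KModel.val_substV (M : KModel B Con) {τ : Ty B} (t : Trm B Con τ)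
    (u : ∀ τ, Nat → M.D τ) (v : ∀ τ : Ty B, Nat → Trm B Con τ) :
    M.Indist (M.val u (substV v t)) (M.val (fun σ n => M.val u (v σ n)) t) := by
  induction t generalizing u v with
  | var τ n =>
    rw [M.val_var]
    exact .refl M _
  | con c =>
    rw [substV, M.val_con, M.val_con]
    exact .refl M _
  | app f a ihf iha =>
    have hf : M.val u (substV v f) = _ := ihf u v
    have ha : M.val u (substV v a) = _ := iha u v
    rw [substV, M.val_app, M.val_app, hf, ha]
    exact .refl M _
  | imp φ ψ ihφ ihψ =>
    have hφ : M.sigma (M.val u (substV v φ)) = _ := ihφ u v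
    have hψ : M.sigma (M.val u (substV v ψ)) = _ := ihψ u v
    ext s
    rw [substV, M.forces_imp, M.forces_imp, hφ, hψ]
  | all τ hτ m φ ih =>
    ext s
    simp only [substV]
    rw [M.forces_all, M.forces_all]
    set k := fresh v ((FV φ).erase (τ, m))
    have hφ : ∀ d, M.sigma (M.val (uupd u τ k d) (substV (vupd v τ m (.var τ k)) φ)) =
        M.sigma (M.val (uupd (fun σ n => M.val u (v σ n)) τ m d) φ) := by
      intro d
      refine (ih _ _ : M.sigma _ = M.sigma _).trans (M.val_congr φ fun y hy => ?_)
      by_cases hym : y = (τ, m)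
      · subst hym
        simp only [vupd_same, uupd_same, M.val_var]
        exact .refl M _
      · rw [uupd_ne _ _ hym, vupd_ne _ _ hym]
        refine M.val_congr _ fun z hz => ?_
        rw [uupd_ne]
        · exact .refl M _
        · rintro rfl
          exact fresh_notMem v (Finset.mem_erase.2 ⟨hym, hy⟩) τ hz
    simp only [hφ]

lemma Forces.mono {M : KModel B Con} {s s' : M.St} {u : ∀ τ, Nat → M.D τ} {φ : Trm B Con .o}
    (hs : M.le s s') (h : Forces M s u φ) : Forces M s' u φ :=
  M.upclosed _ hs h

theorem Deriv.sound {Δ : Set (Trm B Con .o)} {φ : Trm B Con .o} (h : Deriv Δ φ)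
    (M : KModel B Con) (s : M.St) (u : ∀ τ, Nat → M.D τ) (hΔ : ∀ ψ ∈ Δ, Forces M s u ψ) :
    Forces M s u φ := by
  induction h generalizing s u with
  | ax h => exact hΔ _ h
  | impI _ ih =>
    refine (M.forces_imp _ _ _ _).2 fun s' hs hφ => ih s' u ?_
    rintro χ (rfl | hχ)
    · exact hφ
    · exact (hΔ χ hχ).mono hs
  | impE _ _ ih1 ih2 =>
    exact (M.forces_imp _ _ _ _).1 (ih1 s u hΔ) s (M.le_refl s) (ih2 s u hΔ)
  | allI τ hτ m _ hm ih =>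
    refine (M.forces_all _ _ _ _ _ _).2 fun s' hs d => ih s' _ fun ψ hψ => ?_
    have e : M.sigma (M.val u ψ) = M.sigma (M.val (uupd u τ m d) ψ) := by
      refine M.val_congr ψ fun y hy => ?_
      rw [uupd_ne]
      · exact .refl M _
      · rintro rfl
        exact hm ψ hψ hy
    have := (hΔ ψ hψ).mono hs
    rwa [Forces, e] at this
  | @allE Δ τ hτ m φ t _ ih =>
    have h1 := (M.forces_all _ _ _ _ _ _).1 (ih s u hΔ) s (M.le_refl s) (M.val u t)
    have e1 : M.sigma (M.val u (subst1 τ m t φ)) = _ := M.val_substV φ u (vupd vid τ m t)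
    have e2 : M.sigma (M.val (fun σ n => M.val u (vupd vid τ m t σ n)) φ) =
        M.sigma (M.val (uupd u τ m (M.val u t)) φ) := by
      refine M.val_congr φ fun y _ => ?_
      by_cases hym : y = (τ, m)
      · subst hym
        simp only [vupd_same, uupd_same]
        exact .refl M _
      · rw [uupd_ne _ _ hym, vupd_ne _ _ hym, vid, M.val_var]
        exact .refl M _
    rw [Forces, e1, e2]
    exact h1

end Soundness

section Completeness

/-- A state of the canonical model: a consistent set of formulas leaving infinitely many
variables of each type unused. -/
def IsCanonicalState (Γ : Set (Trm B Con .o)) : Prop :=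
  ¬ DerivFrom Γ (.all .o (Or.inl rfl) 0 (.var .o 0)) ∧
    ∀ (τ : Ty B) (n : Nat), ∃ k ≥ n, ∀ ψ ∈ Γ, (τ, k) ∉ FV ψ

lemma exists_unused_insert {Γ : Set (Trm B Con .o)}
    (hΓ : ∀ (τ : Ty B) (n : Nat), ∃ k ≥ n, ∀ ψ ∈ Γ, (τ, k) ∉ FV ψ) (φ : Trm B Con .o)
    (τ : Ty B) (n : Nat) : ∃ k ≥ n, ∀ ψ ∈ insert φ Γ, (τ, k) ∉ FV ψ := by
  obtain ⟨b, hb⟩ := exists_index_bound (Set.finite_singleton φ)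
  obtain ⟨k, hk, hk'⟩ := hΓ τ (max n b)
  refine ⟨k, (le_max_left _ _).trans hk, ?_⟩
  rintro ψ (rfl | hψ) hz
  · exact absurd (hb ψ rfl _ hz) (not_lt.2 ((le_max_right _ _).trans hk))
  · exact hk' ψ hψ hz

/-- The canonical model: domains consist of terms, valuations act as substitutions, and forcing
is derivability. -/
def canonicalModel (B : Type) [DecidableEq B] (Con : Ty B → Type) : KModel B Con where
  St := {Γ : Set (Trm B Con .o) // IsCanonicalState Γ}
  le Γ Γ' := Γ.1 ⊆ Γ'.1
  le_refl _ := subset_rfl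
  le_trans := fun h1 h2 => Set.Subset.trans h1 h2
  le_antisymm := fun h1 h2 => Subtype.ext (Set.Subset.antisymm h1 h2)
  D := Trm B Con
  Dne τ := ⟨.var τ 0⟩
  ap f a := .app f a
  I c := .con c
  sigma φ := {Γ | DerivFrom Γ.1 φ}
  upclosed := fun _ _ _ hs h => h.mono hs
  val u _ t := substV u t
  val_var _ _ _ := rfl
  val_con _ _ _ := rfl
  val_app _ _ _ _ _ := rfl
  forces_imp := by
    intro s u φ ψ
    constructor
    · exact fun h s' hs hφ => (h.mono hs).impE hφ
    · intro h
      refine DerivFrom.impI ?_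
      by_cases hc : DerivFrom (insert (substV u φ) s.1) (.all .o (Or.inl rfl) 0 (.var .o 0))
      · exact hc.exfalso
      · exact h ⟨_, hc, exists_unused_insert s.2.2 _⟩ (Set.subset_insert _ _)
          (.ax (Set.mem_insert _ _))
  forces_all := by
    intro s u τ hτ m φ
    constructor
    · intro h s' hs t
      exact ((h.mono hs).allE t).of_vid_eq
        (vid_subst1_substV t φ u fun y hy => fresh_notMem u hy τ)
    · intro h
      obtain ⟨k, hk, hk'⟩ := s.2.2 τ (fresh u ((FV φ).erase (τ, m)))
      have h1 : DerivFrom s.1 (substV (vupd u τ m (.var τ k)) φ) := h s subset_rfl (.var τ k)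
      refine (h1.allI τ hτ k hk').of_vid_eq (vid_all_rename hτ φ u fun y hy hz => ?_)
      exact absurd (lt_fresh u hy hz) (not_lt.2 hk)
  forces_allpp := by
    intro s u n h
    have h1 : DerivFrom s.1 (substV u (.all .o (Or.inl rfl) n (.var .o n))) := h
    simp only [substV, vupd_same] at h1
    exact s.2.1 h1.exfalso

lemma DerivFrom.of_substV_double {Δ : Set (Trm B Con .o)} {φ : Trm B Con .o}
    (h : DerivFrom (substV (fun τ n => .var τ (2 * n)) '' Δ)
      (substV (fun τ n => .var τ (2 * n)) φ)) : DerivFrom Δ φ := by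
  obtain ⟨Γ, hΓ, hΓfin, hd⟩ := Set.exists_subset_image_finite_and.1 h
  have half : ∀ ψ : Trm B Con .o, substV (fun τ n => .var τ (n / 2))
      (substV (fun τ n => .var τ (2 * n)) ψ) = substV vid ψ := by
    intro ψ
    rw [substV_comp]
    exact substV_congr ψ fun y _ => by simp [substV, vid]
  refine ⟨Γ, hΓ, hΓfin, .of_vid hΓfin ?_⟩
  rw [← half]
  refine hd.substV_weaken (hΓfin.image _) _ hΓfin ?_
  rintro _ ⟨ψ, hψ, rfl⟩ Γ' hΓ' hs
  rw [half]
  exact (Deriv.ax (hs hψ)).to_vid hΓ'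

theorem completeness {Δ : Set (Trm B Con .o)} {φ : Trm B Con .o}
    (h : ∀ (M : KModel B Con) (s : M.St) (u : ∀ τ, Nat → M.D τ),
      (∀ ψ ∈ Δ, Forces M s u ψ) → Forces M s u φ) : DerivFrom Δ φ := by
  apply DerivFrom.of_substV_double
  by_cases hc : DerivFrom (substV (fun τ n => .var τ (2 * n)) '' Δ)
      (.all .o (Or.inl rfl) 0 (.var .o 0))
  · exact hc.exfalso
  · have hst : IsCanonicalState (substV (fun τ n => .var τ (2 * n)) '' Δ) := by
      refine ⟨hc, fun τ n => ⟨2 * n + 1, by omega, ?_⟩⟩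
      rintro _ ⟨ψ, _, rfl⟩ hz
      obtain ⟨y, _, hy⟩ := (mem_FV_substV _ _ _).1 hz
      simp only [FV, Finset.mem_singleton, Prod.mk.injEq] at hy
      omega
    exact h (canonicalModel B Con) ⟨_, hst⟩ (fun τ n => .var τ (2 * n))
      fun ψ hψ => DerivFrom.ax ⟨ψ, hψ, rfl⟩

end Completeness

/-- **Soundness and completeness of the Kripke semantics for PRED2₀ (Theorem 2.6).**
For every set `Δ` of formulas and every formula `φ`:  `Δ ⊩ φ` (truth in all Kripke
models, at all states and valuations forcing `Δ`) holds if and only if `Δ ⊢ φ`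
(some finite subset of `Δ` derives `φ` in PRED2₀). -/
theorem kripke_sound_complete {B : Type} [DecidableEq B] [Finite B]
    {Con : Ty B → Type} [∀ τ : Ty B, Countable (Con τ)]
    (Δ : Set (Trm B Con .o)) (φ : Trm B Con .o) :
    (∀ (M : KModel B Con) (s : M.St) (u : ∀ τ, Nat → M.D τ),
        (∀ ψ ∈ Δ, Forces M s u ψ) → Forces M s u φ) ↔
    DerivFrom Δ φ := by
  constructor
  · exact completeness
  · rintro ⟨Δ', hs, _, hd⟩ M s u h
    exact hd.sound M s u fun ψ hψ => h ψ (hs hψ)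

end PRED2
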